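/- For all integers n \ge 4, the quantity \mathfrak{d}_n = p_{n-1} q_n - p_n q_{n-1} is positive, where q_n = \sum_{k=0}^n \binom{n}{k}^2 k! and p_n = \sum_{k=0}^n \binom{n}{k}^2 k! (2 H_{n-k} - H_k). -/

import Mathlib

open Finset

noncomputable def H (m : ℕ) : ℚ := ∑ j ∈ Finset.range m, (1 : ℚ) / (j + 1)

noncomputable def q (n : ℕ) : ℚ :=
  ∑ k ∈ Finset.range (n + 1), ((n.choose k : ℚ))^2 * (Nat.factorial k : ℚ)

noncomputable def p (n : ℕ) : ℚ :=
  ∑ k ∈ Finset.range (n + 1),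
    ((n.choose k : ℚ))^2 * (Nat.factorial k : ℚ) * (2 * H (n - k) - H k)

/-- `dd n = p_{n-1} q_n - p_n q_{n-1}`, with the conventions `p_{-1} = 1`, `q_{-1} = 0`,
so `dd 0 = 1`. -/
noncomputable def dd : ℕ → ℚ
  | 0 => 1
  | (n + 1) => p n * q (n + 1) - p (n + 1) * q n

theorem H_succ (m : ℕ) : H (m + 1) = H m + 1 / (m + 1) := by
  simp [H, Finset.sum_range_succ]

/-- The summand of `q`. -/
noncomputable def qTerm (n k : ℕ) : ℚ := (n.choose k : ℚ) ^ 2 * (Nat.factorial k : ℚ)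

/-- The summand of `p`. -/
noncomputable def pTerm (n k : ℕ) : ℚ := qTerm n k * (2 * H (n - k) - H k)

theorem qTerm_of_lt {n k : ℕ} (h : n < k) : qTerm n k = 0 := by
  simp [qTerm, Nat.choose_eq_zero_of_lt h]

theorem qTerm_add (k a : ℕ) :
    qTerm (k + a) k =
      (Nat.factorial (k + a) : ℚ) ^ 2 / ((Nat.factorial k : ℚ) * (Nat.factorial a : ℚ) ^ 2) := by
  have hk : (Nat.factorial k : ℚ) ≠ 0 := by positivity
  rw [qTerm, Nat.cast_add_choose]
  field_simp

theorem q_eq_sum_qTerm {n N : ℕ} (h : n < N) : q n = ∑ k ∈ range N, qTerm n k := by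
  refine Finset.sum_subset (range_subset_range.2 h) fun k _ hk => ?_
  exact qTerm_of_lt (by simpa using hk)

theorem p_eq_sum_pTerm {n N : ℕ} (h : n < N) : p n = ∑ k ∈ range N, pTerm n k := by
  refine Finset.sum_subset (range_subset_range.2 h) fun k _ hk => ?_
  change pTerm n k = 0
  rw [pTerm, qTerm_of_lt (by simpa using hk), zero_mul]

/-- The Zeilberger certificate for `q`, in terms of `k` and `b = m + 2 - k`. -/
noncomputable def qCert (k b : ℕ) : ℚ :=
  (Nat.factorial (k + b) : ℚ) ^ 2 /
    ((k + b : ℚ) ^ 2 * (Nat.factorial k : ℚ) * (Nat.factorial b : ℚ) ^ 2) *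
    (k * ((b : ℚ) ^ 2 - b - (k + b)))

/-- The Zeilberger certificate for `p`, obtained from `qCert` by formal differentiation in `k`. -/
noncomputable def pCert (k b : ℕ) : ℚ :=
  (Nat.factorial (k + b) : ℚ) ^ 2 /
    ((k + b : ℚ) ^ 2 * (Nat.factorial k : ℚ) * (Nat.factorial b : ℚ) ^ 2) *
    (k * ((b : ℚ) ^ 2 - b - (k + b)) * (2 * H b - H k) +
      ((b : ℚ) ^ 2 - b - (k + b)) + k * (1 - 2 * b))

theorem qTerm_recurrence {m k : ℕ} (hk : k < m + 2) :
    qTerm (m + 2) k - 2 * (m + 2) * qTerm (m + 1) k + (m + 1) ^ 2 * qTerm m k =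
      qCert (k + 1) (m + 2 - (k + 1)) - qCert k (m + 2 - k) := by
  rcases Nat.lt_succ_iff_lt_or_eq.1 hk with h | rfl
  · obtain ⟨a, rfl⟩ := Nat.exists_eq_add_of_le (Nat.lt_succ_iff.1 h)
    rw [show k + a + 2 - (k + 1) = a + 1 by omega, show k + a + 2 - k = a + 2 by omega,
      show k + a + 2 = k + (a + 2) by omega, show k + a + 1 = k + (a + 1) by omega,
      qTerm_add, qTerm_add, qTerm_add, qCert, qCert,
      show k + 1 + (a + 1) = k + a + 2 by omega, show k + (a + 2) = k + a + 2 by omega,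
      show k + (a + 1) = k + a + 1 by omega]
    simp only [Nat.factorial_succ]
    push_cast
    field_simp
    ring
  · rw [qTerm_of_lt (Nat.lt_succ_self m), show m + 1 = m + 1 + 0 by omega,
      show m + 2 = m + 1 + 1 by omega, qTerm_add, qTerm_add, qCert, qCert]
    simp [Nat.factorial_succ]
    field_simp
    ring

theorem pTerm_recurrence {m k : ℕ} (hk : k < m + 2) :
    pTerm (m + 2) k - 2 * (m + 2) * pTerm (m + 1) k + (m + 1) ^ 2 * pTerm m k =
      pCert (k + 1) (m + 2 - (k + 1)) - pCert k (m + 2 - k) := by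
  unfold pTerm
  rcases Nat.lt_succ_iff_lt_or_eq.1 hk with h | rfl
  · obtain ⟨a, rfl⟩ := Nat.exists_eq_add_of_le (Nat.lt_succ_iff.1 h)
    rw [show k + a + 2 - (k + 1) = a + 1 by omega, show k + a + 2 - k = a + 2 by omega,
      show k + a + 1 - k = a + 1 by omega, show k + a - k = a by omega,
      show k + a + 2 = k + (a + 2) by omega, show k + a + 1 = k + (a + 1) by omega,
      qTerm_add, qTerm_add, qTerm_add, pCert, pCert,
      show k + 1 + (a + 1) = k + a + 2 by omega, show k + (a + 2) = k + a + 2 by omega,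
      show k + (a + 1) = k + a + 1 by omega]
    simp only [Nat.factorial_succ, H_succ]
    push_cast
    field_simp
    ring
  · rw [qTerm_of_lt (Nat.lt_succ_self m), show m + 1 = m + 1 + 0 by omega,
      show m + 2 = m + 1 + 1 by omega, qTerm_add, qTerm_add, pCert, pCert]
    simp [Nat.factorial_succ, H_succ]
    field_simp
    ring

theorem q_recurrence (m : ℕ) :
    q (m + 2) = 2 * (m + 2) * q (m + 1) - (m + 1) ^ 2 * q m := by
  have h := Finset.sum_range_sub (fun k => qCert k (m + 2 - k)) (m + 2)
  rw [← Finset.sum_congr rfl fun k hk => qTerm_recurrence (mem_range.1 hk),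
    Finset.sum_add_distrib, Finset.sum_sub_distrib, ← Finset.mul_sum, ← Finset.mul_sum,
    ← q_eq_sum_qTerm (show m + 1 < m + 2 by omega),
    ← q_eq_sum_qTerm (show m < m + 2 by omega)] at h
  have hq : q (m + 2) = ∑ k ∈ range (m + 2), qTerm (m + 2) k + qTerm (m + 2) (m + 2) :=
    Finset.sum_range_succ _ _
  have hend : qCert (m + 2) (m + 2 - (m + 2)) = -qTerm (m + 2) (m + 2) := by
    simp [qCert, qTerm]
    field_simp
    ring
  have hstart : qCert 0 (m + 2 - 0) = 0 := by simp [qCert]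
  rw [hend, hstart] at h
  linear_combination hq + h

theorem p_recurrence (m : ℕ) :
    p (m + 2) = 2 * (m + 2) * p (m + 1) - (m + 1) ^ 2 * p m - m / (m + 2) := by
  have h := Finset.sum_range_sub (fun k => pCert k (m + 2 - k)) (m + 2)
  rw [← Finset.sum_congr rfl fun k hk => pTerm_recurrence (mem_range.1 hk),
    Finset.sum_add_distrib, Finset.sum_sub_distrib, ← Finset.mul_sum, ← Finset.mul_sum,
    ← p_eq_sum_pTerm (show m + 1 < m + 2 by omega),
    ← p_eq_sum_pTerm (show m < m + 2 by omega)] at h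
  have hp : p (m + 2) = ∑ k ∈ range (m + 2), pTerm (m + 2) k + pTerm (m + 2) (m + 2) :=
    Finset.sum_range_succ _ _
  have hend : pCert (m + 2) (m + 2 - (m + 2)) = -pTerm (m + 2) (m + 2) := by
    simp [pCert, pTerm, qTerm]
    field_simp
    ring
  have hstart : pCert 0 (m + 2 - 0) = m / (m + 2) := by
    simp [pCert]
    field_simp
    ring
  rw [hend, hstart] at h
  linear_combination hp + h

theorem dd_recurrence (m : ℕ) :
    dd (m + 2) = (m + 1) ^ 2 * dd (m + 1) + m / (m + 2) * q (m + 1) := by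
  simp only [dd]
  rw [q_recurrence, p_recurrence]
  ring

theorem q_pos (n : ℕ) : 0 < q n :=
  Finset.sum_pos (fun k hk => by
    have := Nat.choose_pos (Nat.lt_succ_iff.1 (mem_range.1 hk))
    positivity) ⟨0, by simp⟩

theorem dd_four : dd 4 = 2 := by
  norm_num [dd, p, q, H, Finset.sum_range_succ, Nat.choose, Nat.factorial]

theorem dd_pos (n : ℕ) (hn : 4 ≤ n) : 0 < dd n := by
  induction n, hn using Nat.le_induction with
  | base => simp [dd_four]
  | succ n hn ih =>
    obtain ⟨m, rfl⟩ : ∃ m, n = m + 1 := ⟨n - 1, by omega⟩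
    rw [dd_recurrence]
    have := q_pos (m + 1)
    positivity
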